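/- arXiv:2411.12051 — 8 statements merged into one kernel-verified Lean document; each statement's English description precedes it below -/
import Mathlib

section
/- Let E = ℝ^d be a Euclidean space, let U : E → ℝ be convex, and let ∂U : E → E be a subgradient selection of U. Then U has quadratic growth (there exists C > 0 with |U(x)| ≤ C(1+‖x‖²) for all x) if and only if ∂U has linear growth (there exists c > 0 with ‖∂U(x)‖ ≤ c(1+‖x‖) for all x). -/
open scoped RealInnerProductSpace

/-- For a convex `U : ℝ^d → ℝ` with a subgradient selection `dU`, quadratic growth of `U`
is equivalent to linear growth of `dU`. -/
theorem quadratic_growth_iff_subgradient_linear_growth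
    (d : ℕ) (U : EuclideanSpace ℝ (Fin d) → ℝ)
    (hU : ConvexOn ℝ Set.univ U)
    (dU : EuclideanSpace ℝ (Fin d) → EuclideanSpace ℝ (Fin d))
    (hdU : ∀ x y : EuclideanSpace ℝ (Fin d), U x + ⟪dU x, y - x⟫ ≤ U y) :
    (∃ C > 0, ∀ x : EuclideanSpace ℝ (Fin d), |U x| ≤ C * (1 + ‖x‖ ^ 2)) ↔
      (∃ c > 0, ∀ x : EuclideanSpace ℝ (Fin d), ‖dU x‖ ≤ c * (1 + ‖x‖)) := by
  constructor
  · rintro ⟨C, hC, h⟩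
    refine ⟨5 * C, by positivity, fun x => ?_⟩
    have hr := norm_nonneg x
    rcases eq_or_ne (dU x) 0 with h0 | h0
    · rw [h0, norm_zero]
      positivity
    have hg : 0 < ‖dU x‖ := norm_pos_iff.mpr h0
    set v := ((1 + ‖x‖) / ‖dU x‖) • dU x with hv
    have hvn : ‖v‖ = 1 + ‖x‖ := by
      rw [hv, norm_smul, Real.norm_of_nonneg (by positivity)]
      field_simp
    have hvi : ⟪dU x, v⟫ = (1 + ‖x‖) * ‖dU x‖ := by
      rw [hv, real_inner_smul_right, real_inner_self_eq_norm_sq]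
      field_simp
    have hsub := hdU x (x + v)
    rw [add_sub_cancel_left, hvi] at hsub
    have hx := (abs_le.mp (h x)).1
    have hy := (abs_le.mp (h (x + v))).2
    have hyn : ‖x + v‖ ^ 2 ≤ (1 + 2 * ‖x‖) ^ 2 := by
      have := norm_add_le x v
      gcongr
      linarith
    have hyC := mul_le_mul_of_nonneg_left hyn hC.le
    have hCr := mul_nonneg hC.le hr
    refine le_of_mul_le_mul_left ?_ (by positivity : 0 < 1 + ‖x‖)
    nlinarith
  · rintro ⟨c, hc, h⟩
    refine ⟨|U 0| + 2 * c, by positivity, fun x => ?_⟩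
    have hr := norm_nonneg x
    have hlow := hdU 0 x
    have hup := hdU x 0
    rw [sub_zero] at hlow
    rw [zero_sub, inner_neg_right] at hup
    have h0 : ‖dU 0‖ ≤ c := by simpa using h 0
    have hin0 := (abs_le.mp (abs_real_inner_le_norm (dU 0) x)).1
    have hinx := (abs_le.mp (abs_real_inner_le_norm (dU x) x)).2
    have hm0 := mul_le_mul_of_nonneg_right h0 hr
    have hmx := mul_le_mul_of_nonneg_right (h x) hr
    have hU0 := mul_nonneg (abs_nonneg (U 0)) (sq_nonneg ‖x‖)
    have hsq := mul_nonneg hc.le (sq_nonneg (1 - ‖x‖))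
    have hcx := mul_nonneg hc.le (sq_nonneg ‖x‖)
    have hup0 := le_abs_self (U 0)
    have hlow0 := neg_abs_le (U 0)
    rw [abs_le]
    constructor <;> nlinarith
end

section
/- Let U : ℝ^d → ℝ be convex with quadratic growth (there exists C > 0 with |U(x)| ≤ C(1+‖x‖²) for all x), and let g : ℝ^d → ℝ^d be a measurable function such that U is differentiable at Lebesgue-almost every x with gradient g(x). Then for every smooth, compactly supported test function φ : ℝ^d → ℝ, the (vector-valued) integration-by-parts identity ∫_{ℝ^d} e^{−U(x)} ∇φ(x) dx = ∫_{ℝ^d} φ(x) e^{−U(x)} g(x) dx holds; equivalently, e^{−U} admits the weak gradient −e^{−U} g. -/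
open MeasureTheory

/-- Integration by parts of a locally Lipschitz function, with almost everywhere gradient `G`,
against a `C^1` compactly supported function. -/
theorem LocallyLipschitz.integral_smul_gradient_eq_neg
    {E : Type*} [NormedAddCommGroup E] [InnerProductSpace ℝ E] [FiniteDimensional ℝ E]
    [MeasurableSpace E] [BorelSpace E] {μ : Measure E} [μ.IsAddHaarMeasure]
    {f : E → ℝ} (hf : LocallyLipschitz f) {G : E → E} (hGm : AEStronglyMeasurable G μ)
    (hG : ∀ᵐ x ∂μ, HasGradientAt f (G x) x)
    {φ : E → ℝ} (hφ : ContDiff ℝ 1 φ) (hφc : HasCompactSupport φ) :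
    ∫ x, f x • gradient φ x ∂μ = -∫ x, φ x • G x ∂μ := by
  obtain ⟨R, hR⟩ := hφc.isCompact.isBounded.subset_ball (0 : E)
  obtain ⟨K, hK⟩ := (hf.locallyLipschitzOn (s := Metric.closedBall (0 : E) R)
    ).exists_lipschitzOnWith_of_compact (isCompact_closedBall _ _)
  obtain ⟨F, hF, hFf⟩ := hK.extend_real
  obtain ⟨D, hD⟩ := hφ.lipschitzWith_of_hasCompactSupport hφc one_ne_zero
  have hzero : ∀ x ∉ Metric.ball (0 : E) R, φ x = 0 := fun x hx =>
    image_eq_zero_of_notMem_tsupport fun h => hx (hR h)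
  have hloc : ∀ x ∈ Metric.ball (0 : E) R, F =ᶠ[nhds x] f := fun x hx => by
    filter_upwards [Metric.isOpen_ball.mem_nhds hx] with y hy
    exact (hFf (Metric.ball_subset_closedBall hy)).symm
  have hgrad (x : E) : HasGradientAt φ (gradient φ x) x :=
    (hφ.differentiable one_ne_zero x).hasGradientAt
  have hfderiv (x v : E) : inner ℝ v (gradient φ x) = fderiv ℝ φ x v := by
    rw [(hgrad x).hasFDerivAt.fderiv, real_inner_comm]
    simp
  have hgradc : Continuous (gradient φ) :=
    (InnerProductSpace.toDual ℝ E).symm.continuous.comp (hφ.continuous_fderiv one_ne_zero)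
  have hgrads : HasCompactSupport (gradient φ) :=
    (hφc.fderiv ℝ).comp_left (map_zero (InnerProductSpace.toDual ℝ E).symm)
  have hfφ : Integrable (fun x => f x • gradient φ x) μ :=
    (hf.continuous.smul hgradc).integrable_of_hasCompactSupport hgrads.smul_left
  have hφG : Integrable (fun x => φ x • G x) μ := by
    refine ((hφ.continuous.integrable_of_hasCompactSupport hφc).norm.mul_const (K : ℝ)).mono'
      (hφ.continuous.aestronglyMeasurable.smul hGm) ?_
    filter_upwards [hG] with x hx
    by_cases hxR : x ∈ Metric.ball (0 : E) R
    · rw [norm_smul]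
      gcongr
      have := (hx.hasFDerivAt.congr_of_eventuallyEq (hloc x hxR)).le_of_lipschitz hF
      simpa using this
    · simp [hzero x hxR]
  refine ext_inner_left ℝ fun v => ?_
  rw [inner_neg_right, ← integral_inner hfφ, ← integral_inner hφG]
  have key := LipschitzWith.integral_lineDeriv_mul_eq (μ := μ) hF hD hφc v
  have hleft : ∫ x, lineDeriv ℝ F x v * φ x ∂μ = ∫ x, inner ℝ v (φ x • G x) ∂μ := by
    refine integral_congr_ae ?_
    filter_upwards [hG] with x hx
    by_cases hxR : x ∈ Metric.ball (0 : E) R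
    · have h := hx.hasFDerivAt.congr_of_eventuallyEq (hloc x hxR)
      rw [(h.hasLineDerivAt v).lineDeriv, inner_smul_right, real_inner_comm]
      simp [mul_comm]
    · simp [hzero x hxR]
  have hright : ∫ x, lineDeriv ℝ φ x (-v) * F x ∂μ =
      -∫ x, inner ℝ v (f x • gradient φ x) ∂μ := by
    rw [← integral_neg]
    refine integral_congr_ae (.of_forall fun x => ?_)
    have hd := hφ.differentiable one_ne_zero x
    by_cases hxR : x ∈ Metric.ball (0 : E) R
    · simp only [hd.lineDeriv_eq_fderiv, inner_smul_right, hfderiv, map_neg,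
        (hloc x hxR).eq_of_nhds]
      ring
    · have : fderiv ℝ φ x = 0 :=
        image_eq_zero_of_notMem_tsupport fun h => hxR (hR (tsupport_fderiv_subset ℝ h))
      simp [hd.lineDeriv_eq_fderiv, inner_smul_right, hfderiv, this]
  rw [← hleft, key, hright, neg_neg]

/-- Weak chain rule: if `U : ℝ^d → ℝ` is convex with quadratic growth and a.e. differentiable
with gradient `g`, then `e^{-U}` admits the weak gradient `-e^{-U} g`, i.e. the
integration-by-parts identity holds against every smooth compactly supported test function. -/
theorem weak_gradient_of_gibbs_density
    (d : ℕ) (U : EuclideanSpace ℝ (Fin d) → ℝ)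
    (hU : ConvexOn ℝ Set.univ U)
    (C : ℝ) (hC : 0 < C)
    (hgrowth : ∀ x : EuclideanSpace ℝ (Fin d), |U x| ≤ C * (1 + ‖x‖ ^ 2))
    (g : EuclideanSpace ℝ (Fin d) → EuclideanSpace ℝ (Fin d))
    (hgmeas : Measurable g)
    (hg : ∀ᵐ x ∂(volume : Measure (EuclideanSpace ℝ (Fin d))), HasGradientAt U (g x) x)
    (φ : EuclideanSpace ℝ (Fin d) → ℝ)
    (hφ : ContDiff ℝ (⊤ : ℕ∞) φ) (hφc : HasCompactSupport φ) :
    ∫ x : EuclideanSpace ℝ (Fin d), Real.exp (-U x) • gradient φ x ∂volume =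
      ∫ x : EuclideanSpace ℝ (Fin d), (φ x * Real.exp (-U x)) • g x ∂volume := by
  have hexp : LocallyLipschitz fun x => Real.exp (-U x) :=
    (Real.contDiff_exp.comp contDiff_neg).locallyLipschitz.comp hU.locallyLipschitz
  have hG : ∀ᵐ x, HasGradientAt (fun x => Real.exp (-U x)) (-(Real.exp (-U x) • g x)) x := by
    filter_upwards [hg] with x hx
    rw [hasGradientAt_iff_hasFDerivAt] at hx ⊢
    simpa using hx.neg.exp
  have hGm : AEStronglyMeasurable (fun x => -(Real.exp (-U x) • g x)) volume :=
    (hexp.continuous.measurable.smul hgmeas).neg.aestronglyMeasurable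
  rw [hexp.integral_smul_gradient_eq_neg hGm hG (hφ.of_le (by exact_mod_cast le_top)) hφc,
    ← integral_neg]
  simp [mul_smul]
end

section
/- Let U : ℝ^d → ℝ be m-strongly convex (m > 0) with quadratic growth (there exists C > 0 with |U(x)| ≤ C(1+‖x‖²) for all x), and let g : ℝ^d → ℝ^d be a measurable function such that U is differentiable at Lebesgue-almost every x with gradient g(x). Then the Gibbs density e^{−U} is a weak solution of the stationary Fokker–Planck equation: for every smooth, compactly supported test function φ : ℝ^d → ℝ, ∫_{ℝ^d} ( −⟨g(x), ∇φ(x)⟩ + Δφ(x) ) e^{−U(x)} dx = 0, where Δφ denotes the Laplacian of φ. -/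
open MeasureTheory
open scoped RealInnerProductSpace

/-- The Laplacian of `φ : ℝ^d → ℝ`: the sum of the second partial derivatives. -/
noncomputable def laplacian (d : ℕ) (φ : EuclideanSpace ℝ (Fin d) → ℝ)
    (x : EuclideanSpace ℝ (Fin d)) : ℝ :=
  ∑ i : Fin d,
    fderiv ℝ (fun y => fderiv ℝ φ y (EuclideanSpace.single i 1)) x (EuclideanSpace.single i 1)

open scoped Topology

/-- Integration by parts for a locally Lipschitz function against a compactly supported `C¹`
function. -/
theorem LocallyLipschitz.integrable_and_integral_lineDeriv_mul_add_eq_zero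
    {E : Type*} [NormedAddCommGroup E] [NormedSpace ℝ E] [FiniteDimensional ℝ E]
    [MeasurableSpace E] [BorelSpace E] {μ : Measure E} [μ.IsAddHaarMeasure]
    {f ψ : E → ℝ} (hf : LocallyLipschitz f) (hψ : ContDiff ℝ 1 ψ)
    (hψc : HasCompactSupport ψ) (v : E) :
    Integrable (fun x => lineDeriv ℝ f x v * ψ x + fderiv ℝ ψ x v * f x) μ ∧
      ∫ x, (lineDeriv ℝ f x v * ψ x + fderiv ℝ ψ x v * f x) ∂μ = 0 := by
  obtain ⟨R, hR⟩ := hψc.isBounded.subset_ball (0 : E)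
  obtain ⟨K, hK⟩ := LocallyLipschitzOn.exists_lipschitzOnWith_of_compact
    (isCompact_closedBall (0 : E) R) (hf.locallyLipschitzOn (s := Metric.closedBall 0 R))
  obtain ⟨F, hF, hfF⟩ := hK.extend_real
  obtain ⟨D, hD⟩ := ContDiff.lipschitzWith_of_hasCompactSupport hψc hψ (by simp)
  have hlocal : ∀ x ∈ tsupport ψ, f =ᶠ[𝓝 x] F := fun x hx => by
    filter_upwards [Metric.isOpen_ball.mem_nhds (hR hx)] with y hy
    exact hfF (Metric.ball_subset_closedBall hy)
  have hfun : (fun x => lineDeriv ℝ f x v * ψ x + fderiv ℝ ψ x v * f x) =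
      fun x => lineDeriv ℝ F x v * ψ x + fderiv ℝ ψ x v * F x := by
    funext x
    by_cases hx : x ∈ tsupport ψ
    · rw [(hlocal x hx).lineDeriv_eq, (hlocal x hx).eq_of_nhds]
    · rw [image_eq_zero_of_notMem_tsupport hx,
        image_eq_zero_of_notMem_tsupport (fun h => hx (tsupport_fderiv_subset ℝ h))]
      simp
  have h_left : Integrable (fun x => lineDeriv ℝ F x v * ψ x) μ :=
    (hψ.continuous.integrable_of_hasCompactSupport hψc).mul_of_top_right
      (hF.memLp_lineDeriv v)
  have h_right : Integrable (fun x => fderiv ℝ ψ x v * F x) μ :=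
    (((hψ.continuous_fderiv (by simp)).clm_apply continuous_const).mul
      hF.continuous).integrable_of_hasCompactSupport ((hψc.fderiv_apply ℝ v).mul_right)
  rw [hfun]
  refine ⟨h_left.add h_right, ?_⟩
  rw [integral_add h_left h_right, hF.integral_lineDeriv_mul_eq hD hψc]
  simp_rw [((hψ.differentiable (by simp)) _).lineDeriv_eq_fderiv]
  simp [integral_neg]

/-- The Gibbs density `e^{-U}` is a weak solution of the stationary Fokker--Planck equation
for an `m`-strongly convex potential `U` with quadratic growth and a.e. gradient `g`. -/
theorem gibbs_density_weak_solution_stationary_fokker_planck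
    (d : ℕ) (m : ℝ) (hm : 0 < m) (U : EuclideanSpace ℝ (Fin d) → ℝ)
    (hU : ∀ x y : EuclideanSpace ℝ (Fin d), ∀ l : ℝ, l ∈ Set.Icc (0 : ℝ) 1 →
      U (l • x + (1 - l) • y) ≤
        l * U x + (1 - l) * U y - m / 2 * l * (1 - l) * ‖x - y‖ ^ 2)
    (C : ℝ) (hC : 0 < C)
    (hgrowth : ∀ x : EuclideanSpace ℝ (Fin d), |U x| ≤ C * (1 + ‖x‖ ^ 2))
    (g : EuclideanSpace ℝ (Fin d) → EuclideanSpace ℝ (Fin d))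
    (hgmeas : Measurable g)
    (hg : ∀ᵐ x ∂(volume : Measure (EuclideanSpace ℝ (Fin d))), HasGradientAt U (g x) x)
    (φ : EuclideanSpace ℝ (Fin d) → ℝ)
    (hφ : ContDiff ℝ (⊤ : ℕ∞) φ) (hφc : HasCompactSupport φ) :
    ∫ x : EuclideanSpace ℝ (Fin d),
        (-⟪g x, gradient φ x⟫ + laplacian d φ x) * Real.exp (-U x) ∂volume = 0 := by
  have hconv : ConvexOn ℝ Set.univ U := by
    refine ⟨convex_univ, fun x _ y _ a b ha hb hab => ?_⟩
    obtain rfl : b = 1 - a := by linarith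
    refine (hU x y a ⟨ha, by linarith⟩).trans ?_
    have : 0 ≤ m / 2 * a * (1 - a) * ‖x - y‖ ^ 2 := by positivity
    simp only [smul_eq_mul]
    linarith
  have hexp : ContDiff ℝ 1 fun t : ℝ => Real.exp (-t) := by fun_prop
  have hlip : LocallyLipschitz fun x => Real.exp (-U x) :=
    hexp.locallyLipschitz.comp hconv.locallyLipschitz
  let e : Fin d → EuclideanSpace ℝ (Fin d) := fun i => EuclideanSpace.single i 1
  have hparts := fun i => hlip.integrable_and_integral_lineDeriv_mul_add_eq_zero
    (μ := volume) (ψ := fun x => fderiv ℝ φ x (e i))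
    ((hφ.fderiv_right (m := 1) (WithTop.coe_le_coe.2 le_top)).clm_apply contDiff_const)
    (hφc.fderiv_apply ℝ (e i)) (e i)
  calc
    _ = ∫ x, ∑ i, (lineDeriv ℝ (fun x => Real.exp (-U x)) x (e i) * fderiv ℝ φ x (e i) +
        fderiv ℝ (fun x => fderiv ℝ φ x (e i)) x (e i) * Real.exp (-U x)) := by
      refine integral_congr_ae ?_
      filter_upwards [hg] with x hx
      have hline : ∀ i, lineDeriv ℝ (fun x => Real.exp (-U x)) x (e i) =
          -(g x i * Real.exp (-U x)) := fun i => by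
        have h := (hx.hasFDerivAt.neg.exp.hasLineDerivAt (e i)).lineDeriv
        simpa [e, EuclideanSpace.inner_single_right, mul_comm] using h
      have hgrad : ∀ i, gradient φ x i = fderiv ℝ φ x (e i) := fun i => by
        rw [← inner_gradient_left (𝕜 := ℝ), EuclideanSpace.inner_single_right]
        simp
      simp only [hline, laplacian, PiLp.inner_apply, hgrad]
      rw [← Finset.sum_neg_distrib, ← Finset.sum_add_distrib, Finset.sum_mul]
      refine Finset.sum_congr rfl fun i _ => ?_
      simp [e]
      ring
    _ = 0 := by
      rw [integral_finsetSum _ fun i _ => (hparts i).1]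
      exact Finset.sum_eq_zero fun i _ => (hparts i).2
end

section
/- Let U : ℝ^d → ℝ be m-strongly convex (m > 0) and attain its minimum at 0, let ∂U be a subgradient selection of U, and suppose there exist K, c > 0 with ‖∂U(x)‖² ≤ c‖x‖² for all x with ‖x‖ ≥ K. Then for every step size τ with 0 < τ ≤ m/c and every x with ‖x‖ ≥ K, the explicit subgradient step satisfies ‖x − τ ∂U(x)‖² ≤ (1 − mτ) ‖x‖². -/
open scoped RealInnerProductSpace

/-- A subgradient of an `m`-strongly convex function gives a quadratic lower bound. -/
theorem subgradient_quadratic_lower_bound {E : Type*} [NormedAddCommGroup E]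
    [InnerProductSpace ℝ E] {m : ℝ} {U : E → ℝ}
    (hU : ∀ x y : E, ∀ l : ℝ, l ∈ Set.Icc (0 : ℝ) 1 →
      U (l • x + (1 - l) • y) ≤
        l * U x + (1 - l) * U y - m / 2 * l * (1 - l) * ‖x - y‖ ^ 2)
    {x g : E} (hg : ∀ y, U x + ⟪g, y - x⟫ ≤ U y) (y : E) :
    U x + ⟪g, y - x⟫ + m / 2 * ‖y - x‖ ^ 2 ≤ U y := by
  have bound : ∀ l ∈ Set.Ioo (0 : ℝ) 1,
      U x + ⟪g, y - x⟫ + m / 2 * (1 - l) * ‖y - x‖ ^ 2 ≤ U y := by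
    rintro l ⟨hl0, hl1⟩
    have hconv := hU y x l ⟨hl0.le, hl1.le⟩
    have hsub := hg (l • y + (1 - l) • x)
    rw [show l • y + (1 - l) • x - x = l • (y - x) by module, inner_smul_right] at hsub
    refine le_of_mul_le_mul_left ?_ hl0
    linarith
  have hcont : Continuous fun l : ℝ ↦
      U x + ⟪g, y - x⟫ + m / 2 * (1 - l) * ‖y - x‖ ^ 2 := by
    fun_prop
  have hlim := (hcont.tendsto 0).mono_left (nhdsWithin_le_nhds (s := Set.Ioi (0 : ℝ)))
  simp only [sub_zero, mul_one] at hlim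
  refine le_of_tendsto hlim ?_
  filter_upwards [Ioo_mem_nhdsGT (zero_lt_one' ℝ)] with l hl using bound l hl

/-- For an `m`-strongly convex `U` minimized at `0` with subgradient of at most linear growth,
the explicit subgradient step is a contraction outside a ball. -/
theorem explicit_step_contracts_outside_ball
    (d : ℕ) (m : ℝ) (hm : 0 < m) (U : EuclideanSpace ℝ (Fin d) → ℝ)
    (hU : ∀ x y : EuclideanSpace ℝ (Fin d), ∀ l : ℝ, l ∈ Set.Icc (0 : ℝ) 1 →
      U (l • x + (1 - l) • y) ≤
        l * U x + (1 - l) * U y - m / 2 * l * (1 - l) * ‖x - y‖ ^ 2)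
    (hmin : ∀ z : EuclideanSpace ℝ (Fin d), U 0 ≤ U z)
    (dU : EuclideanSpace ℝ (Fin d) → EuclideanSpace ℝ (Fin d))
    (hdU : ∀ x y : EuclideanSpace ℝ (Fin d), U x + ⟪dU x, y - x⟫ ≤ U y)
    (K c : ℝ) (hK : 0 < K) (hc : 0 < c)
    (hgrow : ∀ x : EuclideanSpace ℝ (Fin d), K ≤ ‖x‖ → ‖dU x‖ ^ 2 ≤ c * ‖x‖ ^ 2) :
    ∀ τ : ℝ, 0 < τ → τ ≤ m / c →
      ∀ x : EuclideanSpace ℝ (Fin d), K ≤ ‖x‖ →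
        ‖x - τ • dU x‖ ^ 2 ≤ (1 - m * τ) * ‖x‖ ^ 2 := by
  intro τ hτ hτc x hx
  have hzero := subgradient_quadratic_lower_bound hU (x := 0) (g := 0) (by simpa using hmin) x
  have hstep := subgradient_quadratic_lower_bound hU (hdU x) 0
  simp only [inner_zero_left, sub_zero, zero_sub, add_zero, norm_neg, inner_neg_right]
    at hzero hstep
  have hinner : m * ‖x‖ ^ 2 ≤ ⟪dU x, x⟫ := by linarith
  have hτm : τ * c ≤ m := (le_div_iff₀ hc).mp hτc
  have hgrad : τ * ‖dU x‖ ^ 2 ≤ m * ‖x‖ ^ 2 := calc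
    τ * ‖dU x‖ ^ 2 ≤ τ * (c * ‖x‖ ^ 2) := by gcongr; exact hgrow x hx
    _ = τ * c * ‖x‖ ^ 2 := by ring
    _ ≤ m * ‖x‖ ^ 2 := by gcongr
  rw [norm_sub_sq_real, inner_smul_right, norm_smul, mul_pow, Real.norm_eq_abs, sq_abs,
    real_inner_comm]
  have := mul_le_mul_of_nonneg_left hinner hτ.le
  have := mul_le_mul_of_nonneg_left hgrad hτ.le
  linarith
end

section
/- Let U : ℝ^d → ℝ be convex with subgradient selection ∂U satisfying the linear growth bound ‖∂U(x)‖ ≤ c(1+‖x‖) for all x (c > 0), and suppose there exist α ∈ (0,1] and K ≥ 1 such that ⟨x, ∂U(x)⟩ ≥ α ‖x‖ ‖∂U(x)‖ for all x with ‖x‖ > K (the subgradient points outwards for large x). Then for every step size τ with 0 < τ ≤ α/(2c) and every x with ‖x‖ > K, ‖x − τ ∂U(x)‖² ≤ ‖x‖² − τ α ‖x‖ ‖∂U(x)‖. -/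
open scoped RealInnerProductSpace

/-- If the subgradient of a convex function has linear growth and points outwards for large
arguments, the explicit subgradient step decreases the norm quantitatively. -/
theorem explicit_step_outward_subgradient_estimate
    (d : ℕ) (U : EuclideanSpace ℝ (Fin d) → ℝ)
    (dU : EuclideanSpace ℝ (Fin d) → EuclideanSpace ℝ (Fin d))
    (hdU : ∀ x y : EuclideanSpace ℝ (Fin d), U x + ⟪dU x, y - x⟫ ≤ U y)
    (c : ℝ) (hc : 0 < c)
    (hgrow : ∀ x : EuclideanSpace ℝ (Fin d), ‖dU x‖ ≤ c * (1 + ‖x‖))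
    (α : ℝ) (hα0 : 0 < α) (hα1 : α ≤ 1) (K : ℝ) (hK : 1 ≤ K)
    (hout : ∀ x : EuclideanSpace ℝ (Fin d), K < ‖x‖ → α * (‖x‖ * ‖dU x‖) ≤ ⟪x, dU x⟫) :
    ∀ τ : ℝ, 0 < τ → τ ≤ α / (2 * c) →
      ∀ x : EuclideanSpace ℝ (Fin d), K < ‖x‖ →
        ‖x - τ • dU x‖ ^ 2 ≤ ‖x‖ ^ 2 - τ * α * (‖x‖ * ‖dU x‖) := by
  intro τ hτ hτc x hx
  have hτc' : τ * (2 * c) ≤ α := (le_div_iff₀ (by positivity)).1 hτc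
  have hstep : τ * ‖dU x‖ ≤ α * ‖x‖ := by
    calc τ * ‖dU x‖ ≤ τ * (c * (1 + ‖x‖)) := by gcongr; exact hgrow x
      _ ≤ τ * (c * (‖x‖ + ‖x‖)) := by gcongr; linarith
      _ = τ * (2 * c) * ‖x‖ := by ring
      _ ≤ α * ‖x‖ := by gcongr
  have hquad := mul_le_mul_of_nonneg_left hstep (mul_nonneg hτ.le (norm_nonneg (dU x)))
  have hinner := mul_le_mul_of_nonneg_left (hout x hx) hτ.le
  rw [norm_sub_sq_real, real_inner_smul_right, norm_smul, Real.norm_of_nonneg hτ.le]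
  linarith
end

section
/- Let F : ℝ^d → ℝ be differentiable, m-strongly convex (m > 0), and with L-Lipschitz continuous gradient ∇F (L > 0). Then for every step size τ with 0 < τ ≤ 1/(m+L) and all x, y ∈ ℝ^d, the gradient-descent map x ↦ x − τ∇F(x) is a contraction: ‖(x − τ∇F(x)) − (y − τ∇F(y))‖² ≤ (1 − τ mL/(m+L)) ‖x − y‖². -/
open scoped RealInnerProductSpace

section GradientInequalities

variable {E : Type*} [NormedAddCommGroup E] [InnerProductSpace ℝ E] [CompleteSpace E]

theorem hasDerivAt_comp_add_smul_of_differentiable {F : E → ℝ} (hF : Differentiable ℝ F)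
    (u v : E) (t : ℝ) :
    HasDerivAt (fun s : ℝ => F (u + s • v)) ⟪gradient F (u + t • v), v⟫ t := by
  have hline : HasDerivAt (fun s : ℝ => u + s • v) v t := by
    simpa using ((hasDerivAt_id t).smul_const v).const_add u
  have h := (hF (u + t • v)).hasGradientAt.hasFDerivAt.comp_hasDerivAt t hline
  simpa [Function.comp_def] using h

/-- The descent lemma: a function with `L`-Lipschitz gradient lies below its quadratic upper model. -/
theorem le_add_inner_gradient_add_sq {F : E → ℝ} (hF : Differentiable ℝ F) {L : ℝ}
    (hLip : ∀ x y : E, ‖gradient F x - gradient F y‖ ≤ L * ‖x - y‖) (u v : E) :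
    F (u + v) ≤ F u + ⟪gradient F u, v⟫ + L / 2 * ‖v‖ ^ 2 := by
  let φ : ℝ → ℝ := fun t => F (u + t • v) - t * ⟪gradient F u, v⟫ - L / 2 * ‖v‖ ^ 2 * t ^ 2
  have hφ (t : ℝ) : HasDerivAt φ
      (⟪gradient F (u + t • v), v⟫ - ⟪gradient F u, v⟫ - L * ‖v‖ ^ 2 * t) t := by
    have h := ((hasDerivAt_comp_add_smul_of_differentiable hF u v t).sub
      ((hasDerivAt_id t).mul_const ⟪gradient F u, v⟫)).sub
      ((hasDerivAt_pow 2 t).const_mul (L / 2 * ‖v‖ ^ 2))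
    refine h.congr_deriv ?_
    simp
    ring
  have hanti : AntitoneOn φ (Set.Icc 0 1) := by
    refine antitoneOn_of_deriv_nonpos (convex_Icc 0 1)
      (fun t _ => (hφ t).continuousAt.continuousWithinAt)
      (fun t _ => (hφ t).differentiableAt.differentiableWithinAt) fun t ht => ?_
    rw [interior_Icc] at ht
    rw [(hφ t).deriv, ← inner_sub_left]
    have h₁ := real_inner_le_norm (gradient F (u + t • v) - gradient F u) v
    have h₂ := hLip (u + t • v) u
    rw [add_sub_cancel_left, norm_smul, Real.norm_of_nonneg ht.1.le] at h₂
    nlinarith [mul_le_mul_of_nonneg_right h₂ (norm_nonneg v)]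
  have h := hanti (Set.left_mem_Icc.2 zero_le_one) (Set.right_mem_Icc.2 zero_le_one) zero_le_one
  simp only [φ, one_smul, zero_smul, add_zero] at h
  linarith

/-- A differentiable strongly convex function lies above its quadratic lower model. -/
theorem add_inner_gradient_add_sq_le {F : E → ℝ} (hF : Differentiable ℝ F) {m : ℝ}
    (hSC : ∀ x y : E, ∀ l : ℝ, l ∈ Set.Icc (0 : ℝ) 1 →
      F (l • x + (1 - l) • y) ≤
        l * F x + (1 - l) * F y - m / 2 * l * (1 - l) * ‖x - y‖ ^ 2) (x y : E) :
    F x + ⟪gradient F x, y - x⟫ + m / 2 * ‖y - x‖ ^ 2 ≤ F y := by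
  let φ : ℝ → ℝ := fun t => F (x + t • (y - x)) - m / 2 * ‖y - x‖ ^ 2 * t ^ 2
  have hφ : HasDerivAt φ ⟪gradient F x, y - x⟫ 0 := by
    have h := (hasDerivAt_comp_add_smul_of_differentiable hF x (y - x) 0).sub
      ((hasDerivAt_pow 2 (0 : ℝ)).const_mul (m / 2 * ‖y - x‖ ^ 2))
    refine h.congr_deriv ?_
    simp
  have hslope := hφ.tendsto_slope_zero_right
  have hle : ⟪gradient F x, y - x⟫ ≤ F y - F x - m / 2 * ‖y - x‖ ^ 2 := by
    refine le_of_tendsto hslope ?_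
    filter_upwards [Ioo_mem_nhdsGT (zero_lt_one (α := ℝ))] with t ht
    have h := hSC y x t ⟨ht.1.le, ht.2.le⟩
    have hpt : t • y + (1 - t) • x = x + t • (y - x) := by module
    rw [hpt] at h
    simp only [φ, zero_add, zero_smul, add_zero, smul_eq_mul]
    rw [inv_mul_le_iff₀ ht.1]
    linarith
  linarith

/-- Cocoercivity of the gradient (Baillon–Haddad). -/
theorem norm_gradient_sub_sq_le_mul_inner {F : E → ℝ} (hF : Differentiable ℝ F) {L : ℝ}
    (hL : 0 < L) (hconv : ∀ x y : E, F x + ⟪gradient F x, y - x⟫ ≤ F y)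
    (hLip : ∀ x y : E, ‖gradient F x - gradient F y‖ ≤ L * ‖x - y‖) (x y : E) :
    ‖gradient F x - gradient F y‖ ^ 2 ≤ L * ⟪gradient F x - gradient F y, x - y⟫ := by
  have key (a b : E) : F b + ⟪gradient F b, a - b⟫ +
      L⁻¹ / 2 * ‖gradient F a - gradient F b‖ ^ 2 ≤ F a := by
    have h₁ := hconv b (a + (-L⁻¹) • (gradient F a - gradient F b))
    have h₂ := le_add_inner_gradient_add_sq hF hLip a ((-L⁻¹) • (gradient F a - gradient F b))
    have h₃ := real_inner_self_eq_norm_sq (gradient F a - gradient F b)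
    rw [add_sub_right_comm, inner_add_right, inner_smul_right] at h₁
    rw [inner_smul_right, norm_smul, mul_pow, norm_neg, Real.norm_of_nonneg (by positivity)] at h₂
    rw [inner_sub_left] at h₃
    have h₄ : L / 2 * (L⁻¹ ^ 2 * ‖gradient F a - gradient F b‖ ^ 2) =
        L⁻¹ / 2 * ‖gradient F a - gradient F b‖ ^ 2 := by
      field_simp
    have h₅ := congrArg (L⁻¹ * ·) h₃
    simp only [mul_sub] at h₅
    linarith
  have hxy := key x y
  have hyx := key y x
  rw [norm_sub_rev, ← neg_sub x y, inner_neg_right] at hyx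
  rw [← inv_mul_le_iff₀ hL, inner_sub_left]
  linarith

end GradientInequalities


/-- The gradient-descent map of an `m`-strongly convex function with `L`-Lipschitz gradient is a
contraction for step sizes `0 < τ ≤ 1/(m+L)`. -/
theorem gradient_descent_map_contraction
    (d : ℕ) (m L : ℝ) (hm : 0 < m) (hL : 0 < L)
    (F : EuclideanSpace ℝ (Fin d) → ℝ) (hF : Differentiable ℝ F)
    (hSC : ∀ x y : EuclideanSpace ℝ (Fin d), ∀ l : ℝ, l ∈ Set.Icc (0 : ℝ) 1 →
      F (l • x + (1 - l) • y) ≤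
        l * F x + (1 - l) * F y - m / 2 * l * (1 - l) * ‖x - y‖ ^ 2)
    (hLip : ∀ x y : EuclideanSpace ℝ (Fin d),
      ‖gradient F x - gradient F y‖ ≤ L * ‖x - y‖) :
    ∀ τ : ℝ, 0 < τ → τ ≤ 1 / (m + L) →
      ∀ x y : EuclideanSpace ℝ (Fin d),
        ‖(x - τ • gradient F x) - (y - τ • gradient F y)‖ ^ 2 ≤
          (1 - τ * (m * L / (m + L))) * ‖x - y‖ ^ 2 := by
  intro τ hτ hτle x y
  have hmL : 0 < m + L := by positivity
  have hlower := add_inner_gradient_add_sq_le hF hSC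
  have hcoc := norm_gradient_sub_sq_le_mul_inner hF hL
    (fun a b => by nlinarith [hlower a b, sq_nonneg ‖b - a‖]) hLip x y
  have hmono : m * ‖x - y‖ ^ 2 ≤ ⟪gradient F x - gradient F y, x - y⟫ := by
    have hxy := hlower x y
    have hyx := hlower y x
    rw [norm_sub_rev, ← neg_sub x y, inner_neg_right] at hxy
    rw [inner_sub_left]
    linarith
  have hτL : τ * L ≤ 1 := by
    rw [le_div_iff₀ hmL] at hτle
    nlinarith
  have hrate : m * L / (m + L) ≤ m := by
    rw [div_le_iff₀ hmL]
    nlinarith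
  have hexp : (x - τ • gradient F x) - (y - τ • gradient F y) =
      (x - y) - τ • (gradient F x - gradient F y) := by module
  rw [hexp, norm_sub_sq_real, inner_smul_right, real_inner_comm, norm_smul, mul_pow,
    Real.norm_of_nonneg hτ.le]
  set s := ⟪gradient F x - gradient F y, x - y⟫
  have hs : 0 ≤ s := le_trans (by positivity) hmono
  have hgrad : τ ^ 2 * ‖gradient F x - gradient F y‖ ^ 2 ≤ τ * s :=
    calc τ ^ 2 * ‖gradient F x - gradient F y‖ ^ 2 ≤ τ ^ 2 * (L * s) := by gcongr
      _ = τ * L * (τ * s) := by ring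
      _ ≤ τ * s := mul_le_of_le_one_left (by positivity) hτL
  have hdecrease : τ * (m * L / (m + L) * ‖x - y‖ ^ 2) ≤ τ * s := by
    gcongr
    exact le_trans (by gcongr) hmono
  linarith
end

section
/- Let F : ℝ^d → ℝ be differentiable, m-strongly convex (m > 0), with L-Lipschitz gradient, and let G : ℝ^d → ℝ be convex with 0 a minimizer of G. Then there exists τ₀ > 0 such that for every τ ∈ (0, τ₀] there exists K > 0 with: for every w ∈ ℝ^d and every x with ‖x‖ ≥ K, if p minimizes z ↦ τG(z) + (1/2)‖(x − τ∇F(x) + w) − z‖² over ℝ^d, then ‖p‖ ≤ (1 − τ m/4) ‖x‖ + ‖w‖. -/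
open Filter Topology

section ProximalGradient

variable {E : Type*} [NormedAddCommGroup E] [InnerProductSpace ℝ E]

/-- First-order characterization of strong convexity at a point of differentiability. -/
lemma inner_gradient_sub_le_of_strongly_convex [CompleteSpace E] {F : E → ℝ} {m : ℝ}
    (hSC : ∀ x y : E, ∀ l : ℝ, l ∈ Set.Icc (0 : ℝ) 1 →
      F (l • x + (1 - l) • y) ≤
        l * F x + (1 - l) * F y - m / 2 * l * (1 - l) * ‖x - y‖ ^ 2)
    {x : E} (hF : DifferentiableAt ℝ F x) (y : E) :
    inner ℝ (gradient F x) (y - x) ≤ F y - F x - m / 2 * ‖y - x‖ ^ 2 := by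
  have hline : HasDerivAt (fun l : ℝ => F (x + l • (y - x)))
      (inner ℝ (gradient F x) (y - x)) 0 := by
    have hgrad : HasFDerivAt F (InnerProductSpace.toDual ℝ E (gradient F x))
        (x + (0 : ℝ) • (y - x)) := by
      simpa using hF.hasGradientAt.hasFDerivAt
    have hpath : HasDerivAt (fun l : ℝ => x + l • (y - x)) (y - x) 0 := by
      simpa using ((hasDerivAt_id (0 : ℝ)).smul_const (y - x)).const_add x
    exact hgrad.comp_hasDerivAt (0 : ℝ) hpath
  have hbound : Tendsto (fun l : ℝ => F y - F x - m / 2 * (1 - l) * ‖y - x‖ ^ 2) (𝓝[>] 0)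
      (𝓝 (F y - F x - m / 2 * ‖y - x‖ ^ 2)) := by
    have hcont : Continuous fun l : ℝ => F y - F x - m / 2 * (1 - l) * ‖y - x‖ ^ 2 := by
      fun_prop
    simpa using (hcont.tendsto 0).mono_left nhdsWithin_le_nhds
  refine le_of_tendsto_of_tendsto hline.tendsto_slope_zero_right hbound ?_
  filter_upwards [Ioo_mem_nhdsGT (zero_lt_one' ℝ)] with l hl
  have hsc := hSC y x l ⟨hl.1.le, hl.2.le⟩
  have hpoint : l • y + (1 - l) • x = x + l • (y - x) := by module
  rw [hpoint] at hsc
  simp only [zero_add, zero_smul, add_zero, smul_eq_mul]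
  rw [inv_mul_le_iff₀ hl.1]
  linarith

/-- The gradient of a strongly convex function is strongly monotone. -/
lemma le_inner_gradient_sub_of_strongly_convex [CompleteSpace E] {F : E → ℝ} {m : ℝ}
    (hSC : ∀ x y : E, ∀ l : ℝ, l ∈ Set.Icc (0 : ℝ) 1 →
      F (l • x + (1 - l) • y) ≤
        l * F x + (1 - l) * F y - m / 2 * l * (1 - l) * ‖x - y‖ ^ 2)
    (hF : Differentiable ℝ F) (x y : E) :
    m * ‖x - y‖ ^ 2 ≤ inner ℝ (gradient F x - gradient F y) (x - y) := by
  have hx := inner_gradient_sub_le_of_strongly_convex hSC (hF x) y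
  have hy := inner_gradient_sub_le_of_strongly_convex hSC (hF y) x
  rw [← neg_sub x y, inner_neg_right, norm_neg] at hx
  rw [inner_sub_left]
  linarith

/-- A proximal point has norm at most that of its base point, if the function is minimal at `0`. -/
lemma norm_le_of_isMinOn_prox {G : E → ℝ} (hG : ConvexOn ℝ Set.univ G) (hGmin : ∀ z, G 0 ≤ G z)
    {τ : ℝ} (hτ : 0 ≤ τ) {y p : E}
    (hp : IsMinOn (fun z => τ * G z + (1 / 2) * ‖y - z‖ ^ 2) Set.univ p) :
    ‖p‖ ≤ ‖y‖ := by
  have hinner : 0 ≤ inner ℝ (y - p) p := by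
    have hlim : Tendsto (fun s : ℝ => inner ℝ (y - p) p + s / 2 * ‖p‖ ^ 2) (𝓝[>] 0)
        (𝓝 (inner ℝ (y - p) p)) := by
      have hcont : Continuous fun s : ℝ => inner ℝ (y - p) p + s / 2 * ‖p‖ ^ 2 := by fun_prop
      simpa using (hcont.tendsto 0).mono_left nhdsWithin_le_nhds
    refine ge_of_tendsto hlim ?_
    filter_upwards [Ioo_mem_nhdsGT (zero_lt_one' ℝ)] with s hs
    have hGs : G ((1 - s) • p) ≤ G p := by
      have hconv := hG.2 (Set.mem_univ p) (Set.mem_univ 0) (sub_nonneg.2 hs.2.le) hs.1.le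
        (sub_add_cancel 1 s)
      simp only [smul_zero, add_zero, smul_eq_mul] at hconv
      nlinarith [mul_le_mul_of_nonneg_left (hGmin p) hs.1.le]
    have hmin := isMinOn_iff.1 hp ((1 - s) • p) (Set.mem_univ _)
    have hpoint : y - (1 - s) • p = (y - p) + s • p := by module
    simp only [hpoint, norm_add_sq_real, inner_smul_right, norm_smul, mul_pow, Real.norm_eq_abs,
      sq_abs] at hmin
    have hscaled : 0 ≤ s * (inner ℝ (y - p) p + s / 2 * ‖p‖ ^ 2) := by
      linarith [mul_le_mul_of_nonneg_left hGs hτ]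
    exact nonneg_of_mul_nonneg_right hscaled hs.1
  rw [inner_sub_left, real_inner_self_eq_norm_sq] at hinner
  by_contra! hlt
  nlinarith [real_inner_le_norm y p, norm_nonneg y, norm_nonneg p]

/-- A step along a Lipschitz, strongly monotone direction is a contraction. -/
lemma norm_sub_smul_le_of_le_inner {m L τ : ℝ} (hτ : 0 ≤ τ) (hτL : τ * L ^ 2 ≤ m)
    (hτm : τ * m ≤ 1) {x v : E} (hmono : m * ‖x‖ ^ 2 ≤ inner ℝ v x) (hLip : ‖v‖ ≤ L * ‖x‖) :
    ‖x - τ • v‖ ≤ (1 - τ * m / 2) * ‖x‖ := by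
  have hnonneg : 0 ≤ (1 - τ * m / 2) * ‖x‖ := mul_nonneg (by linarith) (norm_nonneg x)
  refine (sq_le_sq₀ (norm_nonneg _) hnonneg).1 ?_
  rw [norm_sub_sq_real, inner_smul_right, real_inner_comm, norm_smul, mul_pow, Real.norm_eq_abs,
    sq_abs]
  have hv : τ ^ 2 * ‖v‖ ^ 2 ≤ τ * m * ‖x‖ ^ 2 := calc
    τ ^ 2 * ‖v‖ ^ 2 ≤ τ ^ 2 * (L * ‖x‖) ^ 2 := by gcongr
    _ = τ * (τ * L ^ 2) * ‖x‖ ^ 2 := by ring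
    _ ≤ τ * m * ‖x‖ ^ 2 := by gcongr
  nlinarith [mul_le_mul_of_nonneg_left hmono hτ, sq_nonneg (τ * m * ‖x‖)]

end ProximalGradient


/-- Drift estimate for the semi-implicit (proximal-gradient) step: for small step sizes and
large `‖x‖`, the proximal-gradient update contracts the norm up to the noise term. -/
theorem semi_implicit_step_norm_contraction
    (d : ℕ) (m L : ℝ) (hm : 0 < m) (hL : 0 < L)
    (F : EuclideanSpace ℝ (Fin d) → ℝ) (hF : Differentiable ℝ F)
    (hSC : ∀ x y : EuclideanSpace ℝ (Fin d), ∀ l : ℝ, l ∈ Set.Icc (0 : ℝ) 1 →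
      F (l • x + (1 - l) • y) ≤
        l * F x + (1 - l) * F y - m / 2 * l * (1 - l) * ‖x - y‖ ^ 2)
    (hLip : ∀ x y : EuclideanSpace ℝ (Fin d),
      ‖gradient F x - gradient F y‖ ≤ L * ‖x - y‖)
    (G : EuclideanSpace ℝ (Fin d) → ℝ) (hG : ConvexOn ℝ Set.univ G)
    (hGmin : ∀ z : EuclideanSpace ℝ (Fin d), G 0 ≤ G z) :
    ∃ τ₀ > (0 : ℝ), ∀ τ : ℝ, 0 < τ → τ ≤ τ₀ →
      ∃ K > (0 : ℝ), ∀ w x : EuclideanSpace ℝ (Fin d), K ≤ ‖x‖ →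
        ∀ p : EuclideanSpace ℝ (Fin d),
          IsMinOn (fun z => τ * G z + (1 / 2) * ‖(x - τ • gradient F x + w) - z‖ ^ 2)
            Set.univ p →
          ‖p‖ ≤ (1 - τ * m / 4) * ‖x‖ + ‖w‖ := by
  refine ⟨min (m / L ^ 2) (1 / m), by positivity, fun τ hτ hτ₀ =>
    ⟨4 * ‖gradient F 0‖ / m + 1, by positivity, fun w x hx p hp => ?_⟩⟩
  have hτL : τ * L ^ 2 ≤ m := (le_div_iff₀ (by positivity)).1 (hτ₀.trans (min_le_left _ _))
  have hτm : τ * m ≤ 1 := (le_div_iff₀ hm).1 (hτ₀.trans (min_le_right _ _))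
  have hstep : ‖x - τ • (gradient F x - gradient F 0)‖ ≤ (1 - τ * m / 2) * ‖x‖ :=
    norm_sub_smul_le_of_le_inner hτ.le hτL hτm
      (by simpa using le_inner_gradient_sub_of_strongly_convex hSC hF x 0)
      (by simpa using hLip x 0)
  have hgrad : τ * ‖gradient F 0‖ ≤ τ * m / 4 * ‖x‖ := by
    have hle : 4 * ‖gradient F 0‖ / m ≤ ‖x‖ := by linarith
    rw [div_le_iff₀ hm] at hle
    nlinarith
  calc ‖p‖ ≤ ‖x - τ • gradient F x + w‖ := norm_le_of_isMinOn_prox hG hGmin hτ.le hp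
    _ = ‖x - τ • (gradient F x - gradient F 0) - τ • gradient F 0 + w‖ := by
      congr 1
      module
    _ ≤ ‖x - τ • (gradient F x - gradient F 0)‖ + ‖τ • gradient F 0‖ + ‖w‖ :=
      (norm_add_le _ _).trans (by gcongr; exact norm_sub_le _ _)
    _ ≤ (1 - τ * m / 4) * ‖x‖ + ‖w‖ := by
      rw [norm_smul, Real.norm_of_nonneg hτ.le]
      linarith
end

section
/- Let G : ℝ^d → ℝ be convex with 0 a minimizer of G and with quadratic growth (there exists C > 0 such that |G(y)| ≤ C(1+‖y‖²) for all y). Then there exists a constant c̃ > 0 such that for every τ ∈ (0,1], every y ∈ ℝ^d, and every p minimizing z ↦ τG(z) + (1/2)‖y − z‖² over ℝ^d, the Moreau gap satisfies 0 ≤ G(y) − G(p) ≤ c̃ τ (1 + ‖y‖)². -/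
/-- A convex function with quadratic growth is locally Lipschitz, with a constant growing linearly
in the norm of the upper point. -/
theorem ConvexOn.sub_le_of_quadratic_growth {E : Type*} [NormedAddCommGroup E] [NormedSpace ℝ E]
    {G : E → ℝ} (hG : ConvexOn ℝ Set.univ G) {C : ℝ} (hC : 0 ≤ C)
    (hgrowth : ∀ y, |G y| ≤ C * (1 + ‖y‖ ^ 2)) (y p : E) :
    G y - G p ≤ 7 * C * (1 + ‖y‖) * ‖y - p‖ := by
  rcases eq_or_ne y p with rfl | hyp
  · simp
  have hr : 0 < ‖y - p‖ := norm_pos_iff.mpr (sub_ne_zero.mpr hyp)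
  have hs : 0 < 1 + ‖y‖ := by positivity
  set r := ‖y - p‖ with hr_def
  set s := 1 + ‖y‖ with hs_def
  set w : E := y + (s / r) • (y - p) with hw_def
  have hw_norm : ‖w‖ ≤ 2 * s := by
    have h := norm_add_le y ((s / r) • (y - p))
    rw [norm_smul, Real.norm_of_nonneg (by positivity), ← hr_def, div_mul_cancel₀ _ hr.ne'] at h
    linarith
  have hcomb : (s / (r + s)) • p + (r / (r + s)) • w = y := by
    rw [hw_def]
    match_scalars <;> field_simp <;> ring
  have hconv := hG.2 (Set.mem_univ p) (Set.mem_univ w)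
    (by positivity : 0 ≤ s / (r + s)) (by positivity : 0 ≤ r / (r + s)) (by field_simp; ring)
  rw [hcomb, smul_eq_mul, smul_eq_mul, div_mul_eq_mul_div, div_mul_eq_mul_div, ← add_div,
    le_div_iff₀ (by positivity)] at hconv
  have hs_one : 1 ≤ s := by linarith [norm_nonneg y]
  have hdiff : G w - G y ≤ 7 * C * s ^ 2 := by
    have hw := (le_abs_self _).trans (hgrowth w)
    have hy := (neg_le_abs _).trans (hgrowth y)
    have hw_sq : ‖w‖ ^ 2 ≤ (2 * s) ^ 2 := by gcongr
    have hy_sq : ‖y‖ ^ 2 ≤ s ^ 2 := by gcongr; linarith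
    have hsum : 1 + ‖w‖ ^ 2 + (1 + ‖y‖ ^ 2) ≤ 7 * s ^ 2 := by nlinarith
    nlinarith [mul_le_mul_of_nonneg_left hsum hC]
  have hslope : s * (G y - G p) ≤ s * (7 * C * s * r) := by
    nlinarith [mul_le_mul_of_nonneg_left hdiff hr.le]
  exact le_of_mul_le_mul_left hslope hs

/-- The Moreau gap `G(y) - G(prox_{τG}(y))` of a convex function `G` with quadratic growth,
minimized at `0`, is nonnegative and of order `τ (1 + ‖y‖)²`. -/
theorem moreau_gap_estimate
    (d : ℕ) (G : EuclideanSpace ℝ (Fin d) → ℝ) (hG : ConvexOn ℝ Set.univ G)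
    (hmin : ∀ z : EuclideanSpace ℝ (Fin d), G 0 ≤ G z)
    (C : ℝ) (hC : 0 < C)
    (hgrowth : ∀ y : EuclideanSpace ℝ (Fin d), |G y| ≤ C * (1 + ‖y‖ ^ 2)) :
    ∃ c > (0 : ℝ), ∀ τ : ℝ, 0 < τ → τ ≤ 1 →
      ∀ y p : EuclideanSpace ℝ (Fin d),
        IsMinOn (fun z => τ * G z + (1 / 2) * ‖y - z‖ ^ 2) Set.univ p →
          0 ≤ G y - G p ∧ G y - G p ≤ c * τ * (1 + ‖y‖) ^ 2 := by
  refine ⟨98 * C ^ 2, by positivity, fun τ hτ _ y p hp => ?_⟩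
  have hprox : ‖y - p‖ ^ 2 ≤ 2 * τ * (G y - G p) := by
    have h := isMinOn_iff.mp hp y (Set.mem_univ y)
    simp only [sub_self, norm_zero] at h
    linarith
  have hnonneg : 0 ≤ G y - G p :=
    nonneg_of_mul_nonneg_right ((sq_nonneg _).trans hprox) (by positivity)
  refine ⟨hnonneg, ?_⟩
  rcases hnonneg.eq_or_lt with h0 | hpos
  · rw [← h0]
    positivity
  have hlip := hG.sub_le_of_quadratic_growth hC.le hgrowth y p
  refine le_of_mul_le_mul_right ?_ hpos
  calc (G y - G p) * (G y - G p) = (G y - G p) ^ 2 := by ring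
    _ ≤ (7 * C * (1 + ‖y‖) * ‖y - p‖) ^ 2 := by gcongr
    _ = 49 * C ^ 2 * (1 + ‖y‖) ^ 2 * ‖y - p‖ ^ 2 := by ring
    _ ≤ 49 * C ^ 2 * (1 + ‖y‖) ^ 2 * (2 * τ * (G y - G p)) := by gcongr
    _ = 98 * C ^ 2 * τ * (1 + ‖y‖) ^ 2 * (G y - G p) := by ring
end
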